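/- There exists a universal constant C > 0 such that for every ε ∈ (0, 1/2) and every 0 ≤ a ≤ b, the metric entropy of the family F([a,b]) = { f_P : P a Borel probability measure on [a,b] } under the sup-norm over ℕ satisfies log N(ε, F([a,b]), L_∞) ≤ C · comp(ε, P([a,b]), L_∞) · log( (b − a + 1)/ε² ). -/

import Mathlib

open MeasureTheory ProbabilityTheory Set

noncomputable section

/-- Poisson pmf `poi j λ = λ^j e^{-λ}/j!`. -/
def poi (j : ℕ) (lam : ℝ) : ℝ := lam ^ j * Real.exp (-lam) / (Nat.factorial j)

/-- Poisson mixture pmf `f_π(j) = ∫_{[0,1]} poi(j, n r) dπ(r)`. -/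
def pmix (n : ℝ) (π : Measure ℝ) (j : ℕ) : ℝ := ∫ r in Set.Icc (0:ℝ) 1, poi j (n * r) ∂π

/-- Poisson mixture directly in the mean parameter. -/
def pmixT (P : Measure ℝ) (j : ℕ) : ℝ := ∫ θ, poi j θ ∂P

/-- Borel probability measure concentrated on a set `I`. -/
def IsProbOn (π : Measure ℝ) (I : Set ℝ) : Prop := IsProbabilityMeasure π ∧ π Iᶜ = 0

/-- Poisson distribution as a measure on ℕ. -/
def poissonMeasure (lam : ℝ) : Measure ℕ :=
  Measure.sum (fun j => (ENNReal.ofReal (poi j lam)) • Measure.dirac j)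

/-- The NPMLE property: `π` maximizes `Σ_i log f_π(N_i)` over probability measures on `[0,1]`. -/
def IsNPMLE (n : ℝ) {k : ℕ} (N : Fin k → ℕ) (π : Measure ℝ) : Prop :=
  IsProbOn π (Set.Icc 0 1) ∧
  ∀ Q : Measure ℝ, IsProbOn Q (Set.Icc 0 1) →
    ∑ i, Real.log (pmix n Q (N i)) ≤ ∑ i, Real.log (pmix n π (N i))

/-- The histogram distribution `π_P = (1/k) Σ_i δ_{p_i}`. -/
def histMeasure {k : ℕ} (p : Fin k → ℝ) : Measure ℝ :=
  ((k : ENNReal))⁻¹ • ∑ i, Measure.dirac (p i)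

/-- Squared Hellinger distance between pmfs on ℕ. -/
def hellingerSq (f g : ℕ → ℝ) : ℝ := ∑' j, (Real.sqrt (f j) - Real.sqrt (g j)) ^ 2

/-- Hellinger distance between pmfs on ℕ. -/
def hellinger (f g : ℕ → ℝ) : ℝ := Real.sqrt (hellingerSq f g)

/-- 1-Wasserstein distance between measures on ℝ. -/
def W1 (μ ν : Measure ℝ) : ℝ :=
  sInf {c : ℝ | ∃ γ : Measure (ℝ × ℝ), IsProbabilityMeasure γ ∧
    γ.map Prod.fst = μ ∧ γ.map Prod.snd = ν ∧ c = ∫ q, |q.1 - q.2| ∂γ}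

/-- `r`-fattening of a set: `S_r = ∪_{x∈S} [x - r(x), x + r(x)]`. -/
def fatten (r : ℝ → ℝ) (S : Set ℝ) : Set ℝ := ⋃ x ∈ S, Set.Icc (x - r x) (x + r x)

/-- `r` is `t`-large: `r(x) ≥ t` and `r(x) ≥ √(t x)` on `[0,1]`
(i.e. `inf_x min(r(x)²/x, r(x)) ≥ t`). -/
def TLarge (t : ℝ) (r : ℝ → ℝ) : Prop :=
  ∀ x ∈ Set.Icc (0:ℝ) 1, t ≤ r x ∧ Real.sqrt (t * x) ≤ r x

/-- `r`-complement of `S`: union of all `S' ⊆ [0,1]` that are `r`-separated from `S`. -/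
def rcomp (r : ℝ → ℝ) (S : Set ℝ) : Set ℝ :=
  ⋃₀ {S' : Set ℝ | S' ⊆ Set.Icc 0 1 ∧ fatten r S ∩ fatten r S' = ∅}

/-- `r*_t(x) = √(t x) + t`. -/
def rstar (t x : ℝ) : ℝ := Real.sqrt (t * x) + t

/-- Integral probability metric with respect to a function class `F`. -/
def dIPM (F : Set (ℝ → ℝ)) (μ ν : Measure ℝ) : ℝ :=
  ⨆ g : F, |(∫ x, g.1 x ∂μ) - ∫ x, g.1 x ∂ν|

/-- Maximum deviation `M(f,I) = sup_{x,y ∈ I} |f x - f y|`. -/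
def Mdev (f : ℝ → ℝ) (I : Set ℝ) : ℝ :=
  sSup ((fun q : ℝ × ℝ => |f q.1 - f q.2|) '' (I ×ˢ I))

/-- Best uniform polynomial approximation error of degree ≤ D on `I`. -/
def polyErr (D : ℕ) (f : ℝ → ℝ) (I : Set ℝ) : ℝ :=
  sInf {c : ℝ | ∃ q : Polynomial ℝ, q.natDegree ≤ D ∧
    c = sSup ((fun x => |f x - Polynomial.eval x q|) '' I)}

/-- The function class `F_{s,γ,η}`. -/
def Fclass (s : ℕ) (γ : ℝ) (η : ℕ → ℝ) : Set (ℝ → ℝ) :=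
  {f | ∃ ℓ : ℝ → ℝ, ContDiffOn ℝ (s : ℕ∞) ℓ (Set.Ioi 0) ∧ (∀ x, f x = x * ℓ x) ∧
    ∀ r ≤ s, ∀ x ∈ Set.Ioc (0:ℝ) 1,
      |x ^ r * iteratedDeriv r ℓ x| ≤
        (Nat.factorial s : ℝ) * x ^ (γ - 1) * Real.log (1 + 1 / x) ^ (η r)}

/-- `log_+(x) = max(1, log x)`. -/
def logPlus (x : ℝ) : ℝ := max 1 (Real.log x)

/-- Separation assumption with explicit centers `q_1,…,q_L`. -/
def SepCenters {k L : ℕ} (p : Fin k → ℝ) (q : Fin L → ℝ) (s t : ℝ) : Prop :=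
  Function.Injective q ∧ (∀ ℓ, q ℓ ∈ Set.Icc (0:ℝ) 1) ∧
  (∀ i j, i ≠ j → fatten (rstar t) {q i} ∩ fatten (rstar t) {q j} = ∅) ∧
  ∀ i, p i ∈ ⋃ ℓ, fatten (rstar s) {q ℓ}

/-- The separation assumption (Assumption 1) with `L` clusters and parameters `s < t`. -/
def SepAssumption {k : ℕ} (p : Fin k → ℝ) (L : ℕ) (s t : ℝ) : Prop :=
  ∃ q : Fin L → ℝ, SepCenters p q s t

end

noncomputable section

/-- `comp(ε, P([a,b]), L_∞)`: the smallest number of atoms needed to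
`ε`-approximate every Poisson mixture with mixing measure on `[a,b]`
uniformly over ℕ. -/
def compPois (ε a b : ℝ) : ℕ :=
  sInf {m : ℕ | ∀ P : MeasureTheory.Measure ℝ, IsProbOn P (Set.Icc a b) →
    ∃ Q : MeasureTheory.Measure ℝ, MeasureTheory.IsProbabilityMeasure Q ∧
      ∃ S : Finset ℝ, (S : Set ℝ) ⊆ Set.Icc a b ∧ Q ((S : Set ℝ))ᶜ = 0 ∧ S.card ≤ m ∧
        ∀ j : ℕ, |pmixT P j - pmixT Q j| ≤ ε}

end

namespace PoissonMixture

lemma continuous_poi (j : ℕ) : Continuous (poi j) := by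
  unfold poi
  fun_prop

lemma poi_nonneg (j : ℕ) {x : ℝ} (hx : 0 ≤ x) : 0 ≤ poi j x := by
  unfold poi
  positivity

lemma poi_le_one (j : ℕ) {x : ℝ} (hx : 0 ≤ x) : poi j x ≤ 1 := by
  have h := Real.pow_div_factorial_le_exp x hx j
  calc poi j x = x ^ j / j.factorial * Real.exp (-x) := by unfold poi; ring
    _ ≤ Real.exp x * Real.exp (-x) := by gcongr
    _ = 1 := by rw [← Real.exp_add]; simp

lemma exists_hasDerivAt_poi (j : ℕ) {x : ℝ} (hx : 0 ≤ x) :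
    ∃ d : ℝ, HasDerivAt (poi j) d x ∧ |d| ≤ 1 := by
  have hexp : HasDerivAt (fun y : ℝ => Real.exp (-y)) (-Real.exp (-x)) x := by
    simpa using (hasDerivAt_neg x).exp
  rcases j with _ | j
  · refine ⟨-poi 0 x, ?_, ?_⟩
    · have : poi 0 = fun y : ℝ => Real.exp (-y) := by ext y; simp [poi]
      rw [this]
      exact hexp
    · rw [abs_neg, abs_of_nonneg (poi_nonneg 0 hx)]
      exact poi_le_one 0 hx
  · refine ⟨poi j x - poi (j + 1) x, ?_, ?_⟩
    · have h := ((hasDerivAt_pow (j + 1) x).mul hexp).div_const ((j + 1).factorial : ℝ)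
      refine HasDerivAt.congr_deriv (f := poi (j + 1)) h ?_
      have h1 : ((j : ℝ) + 1) ≠ 0 := by positivity
      have h2 : (j.factorial : ℝ) ≠ 0 := by positivity
      simp only [poi, Nat.factorial_succ, Nat.cast_mul, Nat.cast_add, Nat.cast_one,
        Nat.add_sub_cancel]
      field_simp
      ring
    · rw [abs_le]
      have h1 := poi_nonneg j hx
      have h2 := poi_nonneg (j + 1) hx
      have h3 := poi_le_one j hx
      have h4 := poi_le_one (j + 1) hx
      constructor <;> linarith

lemma abs_poi_sub_le (j : ℕ) {x y : ℝ} (hx : 0 ≤ x) (hy : 0 ≤ y) :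
    |poi j x - poi j y| ≤ |x - y| := by
  choose! d hd hd1 using fun z (hz : z ∈ Ici (0 : ℝ)) => exists_hasDerivAt_poi j hz
  have h := (convex_Ici (0 : ℝ)).norm_image_sub_le_of_norm_hasDerivWithin_le
    (fun z hz => (hd z hz).hasDerivWithinAt) hd1 (mem_Ici.2 hy) (mem_Ici.2 hx)
  simpa using h

section IsProbOn

variable {P : Measure ℝ} {a b : ℝ}

lemma ae_mem_Icc (hP : IsProbOn P (Icc a b)) : ∀ᵐ θ ∂P, θ ∈ Icc a b := hP.2

lemma integrable_poi (ha : 0 ≤ a) (hP : IsProbOn P (Icc a b)) (j : ℕ) :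
    Integrable (poi j) P := by
  have := hP.1
  refine Integrable.of_bound (continuous_poi j).aestronglyMeasurable 1 ?_
  filter_upwards [ae_mem_Icc hP] with θ hθ
  have h0 : 0 ≤ θ := ha.trans hθ.1
  rw [Real.norm_of_nonneg (poi_nonneg j h0)]
  exact poi_le_one j h0

end IsProbOn

/-- Rounding down to the grid of step `r` anchored at `a`. -/
noncomputable def gridFloor (a r x : ℝ) : ℝ := a + r * ⌊(x - a) / r⌋₊

lemma measurable_gridFloor (a r : ℝ) : Measurable (gridFloor a r) := by
  unfold gridFloor
  fun_prop

lemma gridFloor_le {a r x : ℝ} (hr : 0 < r) (hx : a ≤ x) : gridFloor a r x ≤ x := by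
  have h := Nat.floor_le (div_nonneg (sub_nonneg.2 hx) hr.le)
  rw [le_div_iff₀ hr] at h
  unfold gridFloor
  linarith

lemma le_gridFloor {a r x : ℝ} (hr : 0 < r) : a ≤ gridFloor a r x := by
  unfold gridFloor
  have : 0 ≤ r * (⌊(x - a) / r⌋₊ : ℝ) := by positivity
  linarith

lemma abs_sub_gridFloor_le {a r x : ℝ} (hr : 0 < r) (hx : a ≤ x) :
    |x - gridFloor a r x| ≤ r := by
  rw [abs_of_nonneg (sub_nonneg.2 (gridFloor_le hr hx))]
  have h := (Nat.lt_floor_add_one ((x - a) / r)).le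
  rw [div_le_iff₀ hr] at h
  unfold gridFloor
  linarith

lemma abs_poi_sub_gridFloor_le {a r x : ℝ} (ha : 0 ≤ a) (hr : 0 < r) (hx : a ≤ x) (j : ℕ) :
    |poi j x - poi j (gridFloor a r x)| ≤ r :=
  (abs_poi_sub_le j (ha.trans hx) (ha.trans (le_gridFloor hr))).trans
    (abs_sub_gridFloor_le hr hx)

/-- The number of grid points of step `r` in an interval of length `h`. -/
noncomputable def gridCard (h r : ℝ) : ℕ := ⌊h / r⌋₊ + 1

/-- The grid of step `r` in `[a, b]`, anchored at `a`. -/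
noncomputable def grid (a b r : ℝ) : Finset ℝ :=
  (Finset.range (gridCard (b - a) r)).image fun k : ℕ => a + r * k

lemma card_grid_le (a b r : ℝ) : (grid a b r).card ≤ gridCard (b - a) r :=
  Finset.card_image_le.trans (Finset.card_range _).le

lemma gridFloor_mem_grid {a b r x : ℝ} (hr : 0 < r) (hx : x ≤ b) :
    gridFloor a r x ∈ grid a b r := by
  refine Finset.mem_image.2 ⟨⌊(x - a) / r⌋₊, ?_, rfl⟩
  rw [Finset.mem_range, gridCard, Nat.lt_succ_iff]
  exact Nat.floor_le_floor (by gcongr)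

lemma grid_subset_Icc {a b r : ℝ} (hab : a ≤ b) (hr : 0 < r) : (grid a b r : Set ℝ) ⊆ Icc a b := by
  intro y hy
  obtain ⟨k, hk, rfl⟩ := Finset.mem_image.1 (Finset.mem_coe.1 hy)
  rw [Finset.mem_range, gridCard, Nat.lt_succ_iff] at hk
  have h : (k : ℝ) ≤ (b - a) / r :=
    (Nat.le_floor_iff (div_nonneg (sub_nonneg.2 hab) hr.le)).1 hk
  rw [le_div_iff₀ hr] at h
  have h0 : 0 ≤ r * (k : ℝ) := by positivity
  constructor <;> linarith

lemma gridCard_le {h r : ℝ} (hh : 0 ≤ h) (hr : 0 < r) : (gridCard h r : ℝ) ≤ h / r + 1 := by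
  unfold gridCard
  push_cast
  gcongr
  exact Nat.floor_le (div_nonneg hh hr.le)

section Rounding

variable {P : Measure ℝ} {a b r : ℝ}

lemma map_gridFloor_compl_grid (hr : 0 < r) (hP : IsProbOn P (Icc a b)) :
    P.map (gridFloor a r) (grid a b r : Set ℝ)ᶜ = 0 := by
  rw [Measure.map_apply (measurable_gridFloor a r) (Finset.measurableSet _).compl]
  refine measure_mono_null (fun x hx => ?_) hP.2
  exact fun hx' => hx (gridFloor_mem_grid hr hx'.2)

lemma abs_pmixT_sub_pmixT_map_le (ha : 0 ≤ a) (hr : 0 < r) (hP : IsProbOn P (Icc a b)) (j : ℕ) :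
    |pmixT P j - pmixT (P.map (gridFloor a r)) j| ≤ r := by
  have := hP.1
  have hm := measurable_gridFloor a r
  have hint : Integrable (fun θ => poi j (gridFloor a r θ)) P := by
    refine Integrable.of_bound ((continuous_poi j).measurable.comp hm).aestronglyMeasurable 1 ?_
    refine Filter.Eventually.of_forall fun θ => ?_
    have h0 : 0 ≤ gridFloor a r θ := ha.trans (le_gridFloor hr)
    rw [Real.norm_of_nonneg (poi_nonneg j h0)]
    exact poi_le_one j h0
  unfold pmixT
  rw [integral_map hm.aemeasurable (continuous_poi j).aestronglyMeasurable,
    ← integral_sub (integrable_poi ha hP j) hint]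
  have h := norm_integral_le_of_norm_le_const (μ := P) (C := r)
    (f := fun θ => poi j θ - poi j (gridFloor a r θ))
    (by filter_upwards [ae_mem_Icc hP] with θ hθ using abs_poi_sub_gridFloor_le ha hr hθ.1 j)
  simpa using h

/-- Some grid cell carries at least the average mass. -/
lemma exists_cell (hr : 0 < r) (hP : IsProbOn P (Icc a b)) :
    ∃ y ∈ grid a b r, (gridCard (b - a) r : ℝ)⁻¹ ≤ P.real (gridFloor a r ⁻¹' {y}) := by
  have := hP.1
  have hm := measurable_gridFloor a r
  have : IsProbabilityMeasure (P.map (gridFloor a r)) :=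
    Measure.isProbabilityMeasure_map hm.aemeasurable
  have hone : (P.map (gridFloor a r)).real (grid a b r : Set ℝ) = 1 := by
    rw [measureReal_def, (prob_compl_eq_zero_iff (Finset.measurableSet _)).1
      (map_gridFloor_compl_grid hr hP)]
    rfl
  rw [← sum_measureReal_singleton] at hone
  have hne : (grid a b r).Nonempty := by
    rw [Finset.nonempty_iff_ne_empty]
    intro h
    simp [h] at hone
  obtain ⟨y, hy, hle⟩ := Finset.exists_le_of_sum_le (s := grid a b r) hne
    (f := fun _ => (gridCard (b - a) r : ℝ)⁻¹)
    (g := fun y => (P.map (gridFloor a r)).real {y}) (by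
      rw [hone, Finset.sum_const, nsmul_eq_mul, ← div_eq_mul_inv]
      refine div_le_one_of_le₀ ?_ (by positivity)
      exact_mod_cast card_grid_le a b r)
  refine ⟨y, hy, ?_⟩
  rwa [map_measureReal_apply hm (measurableSet_singleton y)] at hle

end Rounding

lemma exists_probOn_setIntegral_compl {P : Measure ℝ} {I A : Set ℝ} (hP : IsProbOn P I)
    (hA : MeasurableSet A) :
    ∃ P' : Measure ℝ, IsProbOn P' I ∧
      ∀ j, ∫ θ in Aᶜ, poi j θ ∂P = (1 - P.real A) * pmixT P' j := by
  have := hP.1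
  have hc : P.real Aᶜ = 1 - P.real A := probReal_compl_eq_one_sub hA
  by_cases h : P Aᶜ = 0
  · refine ⟨P, hP, fun j => ?_⟩
    rw [← hc, Measure.restrict_eq_zero.2 h, measureReal_def, h]
    simp
  · refine ⟨cond P Aᶜ, ⟨cond_isProbabilityMeasure h, ?_⟩, fun j => ?_⟩
    · exact cond_absolutelyContinuous hP.2
    · have hne : P.real Aᶜ ≠ 0 := by
        rw [measureReal_def]
        exact ENNReal.toReal_ne_zero.2 ⟨h, measure_ne_top _ _⟩
      rw [pmixT, ProbabilityTheory.cond, integral_smul_measure, ← hc, ENNReal.toReal_inv,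
        ← measureReal_def, smul_eq_mul, mul_inv_cancel_left₀ hne]

/-- A finitely supported mixture is a convex combination of Poisson pmfs. -/
lemma exists_weights {Q : Measure ℝ} [IsProbabilityMeasure Q] {S : Finset ℝ} {I : Set ℝ} {m : ℕ}
    (hSI : (S : Set ℝ) ⊆ I) (hQS : Q (S : Set ℝ)ᶜ = 0) (hcard : S.card ≤ m) :
    ∃ x w : Fin m → ℝ, (∀ i, x i ∈ I) ∧ (∀ i, 0 ≤ w i) ∧ ∑ i, w i = 1 ∧
      ∀ j, pmixT Q j = ∑ i, w i * poi j (x i) := by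
  have hone : ∑ y ∈ S, Q.real {y} = 1 := by
    rw [sum_measureReal_singleton, measureReal_def,
      (prob_compl_eq_zero_iff (Finset.measurableSet _)).1 hQS]
    rfl
  obtain ⟨y₀, hy₀⟩ : S.Nonempty := by
    rw [Finset.nonempty_iff_ne_empty]
    rintro rfl
    simp at hone
  let e : S → Fin m := fun y => Fin.castLE hcard (S.equivFin y)
  have he : Function.Injective e := (Fin.castLE_injective hcard).comp S.equivFin.injective
  refine ⟨Function.extend e (fun y => (y : ℝ)) (fun _ => y₀),
    Function.extend e (fun y => Q.real {(y : ℝ)}) 0, fun i => ?_, fun i => ?_, ?_, fun j => ?_⟩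
  · by_cases h : ∃ y, e y = i
    · obtain ⟨y, rfl⟩ := h
      rw [he.extend_apply]
      exact hSI y.2
    · rw [Function.extend_apply' _ _ _ h]
      exact hSI hy₀
  · by_cases h : ∃ y, e y = i
    · obtain ⟨y, rfl⟩ := h
      rw [he.extend_apply]
      positivity
    · rw [Function.extend_apply' _ _ _ h]
      rfl
  · rw [← hone, ← Finset.sum_coe_sort S]
    symm
    refine Fintype.sum_of_injective e he _ _ (fun i hi => ?_) fun y => ?_
    · exact Function.extend_apply' _ _ _ hi
    · rw [he.extend_apply]
  · have hQ : Q.restrict (S : Set ℝ) = Q := Measure.restrict_eq_self_of_ae_mem hQS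
    have hsum : pmixT Q j = ∑ y ∈ S, Q.real {y} * poi j y := by
      have hint : IntegrableOn (poi j) (S : Set ℝ) Q :=
        (continuous_poi j).continuousOn.integrableOn_compact S.finite_toSet.isCompact
      have h := setIntegral_finset S hint
      rw [hQ] at h
      simpa [pmixT] using h
    rw [hsum, ← Finset.sum_coe_sort]
    refine Fintype.sum_of_injective e he _ _ (fun i hi => ?_) fun y => ?_
    · rw [Function.extend_apply' _ _ _ hi]
      simp
    · rw [he.extend_apply, he.extend_apply]

open Classical in
/-- Poisson combinations with `M` terms whose parameters and weights lie on grids of step `s`. -/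
noncomputable def net (a b s : ℝ) (M : ℕ) : Finset (ℕ → ℝ) :=
  (Fintype.piFinset fun _ : Fin M => grid a b s ×ˢ grid 0 1 s).image
    fun c j => ∑ i, (c i).2 * poi j (c i).1

open Classical in
lemma card_net_le (a b s : ℝ) (M : ℕ) :
    (net a b s M).card ≤ (gridCard (b - a) s * gridCard 1 s) ^ M := by
  refine Finset.card_image_le.trans ?_
  rw [Fintype.card_piFinset_const, Finset.card_product]
  have h := card_grid_le 0 1 s
  rw [sub_zero] at h
  gcongr
  exact card_grid_le a b s

open Classical in
lemma exists_mem_net {a b s : ℝ} (ha : 0 ≤ a) (hs : 0 < s) {M : ℕ} {x w : Fin M → ℝ}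
    (hx : ∀ i, x i ∈ Icc a b) (hw : ∀ i, 0 ≤ w i) (hsum : ∑ i, w i = 1) :
    ∃ g ∈ net a b s M, ∀ j, |∑ i, w i * poi j (x i) - g j| ≤ (M + 1) * s := by
  refine ⟨_, Finset.mem_image_of_mem _ (a := fun i => (gridFloor a s (x i), gridFloor 0 s (w i)))
    (Fintype.mem_piFinset.2 fun i =>
      Finset.mk_mem_product (gridFloor_mem_grid hs (hx i).2) (gridFloor_mem_grid hs ?_)),
    fun j => ?_⟩
  · rw [← hsum]
    exact Finset.single_le_sum (fun i _ => hw i) (Finset.mem_univ i)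
  · rw [← Finset.sum_sub_distrib]
    have hterm : ∀ i, |w i * poi j (x i) - gridFloor 0 s (w i) * poi j (gridFloor a s (x i))|
        ≤ w i * s + s := by
      intro i
      have h0 : 0 ≤ gridFloor a s (x i) := ha.trans (le_gridFloor hs)
      have h1 := abs_poi_sub_gridFloor_le ha hs (hx i).1 j
      have h2 := abs_sub_gridFloor_le hs (hw i)
      calc _ = |w i * (poi j (x i) - poi j (gridFloor a s (x i)))
            + (w i - gridFloor 0 s (w i)) * poi j (gridFloor a s (x i))| := by ring_nf
        _ ≤ |w i * (poi j (x i) - poi j (gridFloor a s (x i)))|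
            + |(w i - gridFloor 0 s (w i)) * poi j (gridFloor a s (x i))| := abs_add_le _ _
        _ ≤ w i * s + s * 1 := by
            rw [abs_mul, abs_mul, abs_of_nonneg (hw i), abs_of_nonneg (poi_nonneg j h0)]
            exact add_le_add (mul_le_mul_of_nonneg_left h1 (hw i))
              (mul_le_mul h2 (poi_le_one j h0) (poi_nonneg j h0) hs.le)
        _ = w i * s + s := by ring
    calc _ ≤ ∑ i, (w i * s + s) :=
          (Finset.abs_sum_le_sum_abs _ _).trans (Finset.sum_le_sum fun i _ => hterm i)
      _ = (M + 1) * s := by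
          rw [Finset.sum_add_distrib, ← Finset.sum_mul, hsum]
          simp
          ring

/-- `m` atoms in `[a, b]` suffice to approximate every Poisson mixture within `ε`. -/
def AtomsSuffice (ε a b : ℝ) (m : ℕ) : Prop :=
  ∀ P : Measure ℝ, IsProbOn P (Icc a b) →
    ∃ Q : Measure ℝ, IsProbabilityMeasure Q ∧
      ∃ S : Finset ℝ, (S : Set ℝ) ⊆ Icc a b ∧ Q ((S : Set ℝ))ᶜ = 0 ∧ S.card ≤ m ∧
        ∀ j : ℕ, |pmixT P j - pmixT Q j| ≤ ε

section AtomsSuffice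

variable {ε a b r : ℝ}

lemma atomsSuffice_gridCard (ha : 0 ≤ a) (hab : a ≤ b) (hr : 0 < r) (hrε : r ≤ ε) :
    AtomsSuffice ε a b (gridCard (b - a) r) := by
  intro P hP
  have := hP.1
  exact ⟨P.map (gridFloor a r),
    Measure.isProbabilityMeasure_map (measurable_gridFloor a r).aemeasurable, grid a b r,
    grid_subset_Icc hab hr, map_gridFloor_compl_grid hr hP, card_grid_le a b r,
    fun j => (abs_pmixT_sub_pmixT_map_le ha hr hP j).trans hrε⟩

lemma AtomsSuffice.pos {m : ℕ} (hab : a ≤ b) (h : AtomsSuffice ε a b m) : 0 < m := by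
  have hP : IsProbOn (Measure.dirac a) (Icc a b) := by
    refine ⟨inferInstance, ?_⟩
    rw [Measure.dirac_apply' _ measurableSet_Icc.compl]
    simp [hab]
  obtain ⟨Q, hQ, S, -, hQS, hcard, -⟩ := h _ hP
  rcases Nat.eq_zero_or_pos m with rfl | hm
  · rw [Finset.card_eq_zero.1 (Nat.le_zero.1 hcard)] at hQS
    simp at hQS
  · exact hm

/-- One extra atom, placed in a cell of mass at least `1 / gridCard`, makes the approximation
strictly better than `ε`. -/
lemma AtomsSuffice.exists_improved {m : ℕ} (ha : 0 ≤ a) (hab : a ≤ b) (hr : 0 < r) (hrε : r ≤ ε)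
    (h : AtomsSuffice ε a b m) {P : Measure ℝ} (hP : IsProbOn P (Icc a b)) :
    ∃ x w : Fin (m + 1) → ℝ, (∀ i, x i ∈ Icc a b) ∧ (∀ i, 0 ≤ w i) ∧ ∑ i, w i = 1 ∧
      ∀ j, |pmixT P j - ∑ i, w i * poi j (x i)| ≤
        ε - (gridCard (b - a) r : ℝ)⁻¹ * (ε - r) := by
  have := hP.1
  obtain ⟨y, hy, hη⟩ := exists_cell hr hP
  set A := gridFloor a r ⁻¹' {y}
  have hA : MeasurableSet A := measurable_gridFloor a r (measurableSet_singleton y)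
  set η := P.real A
  have hη1 : η ≤ 1 := measureReal_le_one
  have hη0 : 0 ≤ η := measureReal_nonneg
  obtain ⟨P', hP', hint⟩ := exists_probOn_setIntegral_compl hP hA
  obtain ⟨Q, hQ, S, hSI, hQS, hcard, hPQ⟩ := h P' hP'
  obtain ⟨x, w, hx, hw, hsum, hQw⟩ := exists_weights hSI hQS hcard
  refine ⟨Fin.cons y x, Fin.cons η fun i => (1 - η) * w i, ?_, ?_, ?_, fun j => ?_⟩
  · exact Fin.cases (grid_subset_Icc hab hr hy) hx
  · exact Fin.cases hη0 fun i => mul_nonneg (sub_nonneg.2 hη1) (hw i)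
  · simp [Fin.sum_univ_succ, ← Finset.mul_sum, hsum]
  · have hcell : |∫ θ in A, poi j θ ∂P - η * poi j y| ≤ η * r := by
      have hc : η * poi j y = ∫ _ in A, poi j y ∂P := by simp [η]
      rw [hc, ← integral_sub (integrable_poi ha hP j).integrableOn (integrable_const _)]
      have hb := norm_setIntegral_le_of_norm_le_const_ae' (μ := P) (s := A) (C := r)
        (f := fun θ => poi j θ - poi j y) (measure_lt_top P A) (by
          filter_upwards [ae_mem_Icc hP] with θ hθ hθA
          have : gridFloor a r θ = y := hθA
          rw [← this]
          exact abs_poi_sub_gridFloor_le ha hr hθ.1 j)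
      rw [mul_comm]
      exact hb
    have hsplit : pmixT P j = ∫ θ in A, poi j θ ∂P + (1 - η) * pmixT P' j := by
      rw [← hint j]
      exact (integral_add_compl hA (integrable_poi ha hP j)).symm
    have hmix : ∑ i, (Fin.cons η fun i => (1 - η) * w i : Fin (m + 1) → ℝ) i *
        poi j ((Fin.cons y x : Fin (m + 1) → ℝ) i) = η * poi j y + (1 - η) * pmixT Q j := by
      simp [Fin.sum_univ_succ, hQw, Finset.mul_sum, mul_assoc]
    rw [hmix, hsplit]
    calc _ = |(∫ θ in A, poi j θ ∂P - η * poi j y) + (1 - η) * (pmixT P' j - pmixT Q j)| := by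
          ring_nf
      _ ≤ η * r + (1 - η) * ε := by
          refine (abs_add_le _ _).trans (add_le_add hcell ?_)
          rw [abs_mul, abs_of_nonneg (sub_nonneg.2 hη1)]
          exact mul_le_mul_of_nonneg_left (hPQ j) (sub_nonneg.2 hη1)
      _ ≤ _ := by nlinarith [mul_le_mul_of_nonneg_right hη (sub_nonneg.2 hrε)]

end AtomsSuffice

end PoissonMixture

open PoissonMixture

/-- metric entropy bound for Poisson mixture families
(Lemma `npmle-metric-entropy`): there exists an `ε`-net `T` of
`F([a,b]) = {f_P}` with `log |T| ≤ C · comp(ε) · log((b-a+1)/ε²)`. -/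
theorem stmt18 :
    ∃ C : ℝ, 0 < C ∧
    ∀ ε : ℝ, 0 < ε → ε < 1 / 2 →
    ∀ a b : ℝ, 0 ≤ a → a ≤ b →
    ∃ T : Finset (ℕ → ℝ),
      (∀ P : MeasureTheory.Measure ℝ, IsProbOn P (Set.Icc a b) →
        ∃ g ∈ T, ∀ j : ℕ, |pmixT P j - g j| ≤ ε) ∧
      Real.log T.card ≤ C * compPois ε a b * Real.log ((b - a + 1) / ε ^ 2) := by
  refine ⟨26, by norm_num, fun ε hε hε2 a b ha hab => ?_⟩
  set K := b - a + 1
  have hK : 1 ≤ K := by linarith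
  set m := compPois ε a b
  have hr : 0 < ε / 4 := by positivity
  have hn : AtomsSuffice ε a b (gridCard (b - a) (ε / 4)) :=
    atomsSuffice_gridCard ha hab hr (by linarith)
  have hm : AtomsSuffice ε a b m := Nat.sInf_mem (s := {m | AtomsSuffice ε a b m}) ⟨_, hn⟩
  have hmn : m ≤ gridCard (b - a) (ε / 4) := Nat.sInf_le hn
  have hm1 : (1 : ℝ) ≤ m := by exact_mod_cast hm.pos hab
  have hcardK : (gridCard (b - a) (ε / 4) : ℝ) ≤ 4 * K / ε := by
    refine (gridCard_le (sub_nonneg.2 hab) hr).trans ?_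
    rw [div_add_one hr.ne', div_le_div_iff₀ hr hε]
    nlinarith
  set s := ε ^ 3 / (64 * K ^ 2) with hs_def
  have hs : 0 < s := by positivity
  refine ⟨net a b s (m + 1), fun P hP => ?_, ?_⟩
  · obtain ⟨x, w, hx, hw, hsum, happrox⟩ := hm.exists_improved ha hab hr (by linarith) hP
    obtain ⟨g, hg, hgx⟩ := exists_mem_net ha hs hx hw hsum
    refine ⟨g, hg, fun j => ?_⟩
    have hgain : ε / (4 * K) ≤ (gridCard (b - a) (ε / 4) : ℝ)⁻¹ := by
      rw [← inv_div]
      exact inv_anti₀ (by unfold gridCard; positivity) hcardK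
    have hround : ((m + 1 : ℕ) + 1 : ℝ) * s ≤ ε / (4 * K) * (ε - ε / 4) := by
      have hM : ((m + 1 : ℕ) + 1 : ℝ) ≤ 12 * K / ε := by
        have h1 : (m : ℝ) ≤ 4 * K / ε := le_trans (by exact_mod_cast hmn) hcardK
        have h2 : 2 ≤ 8 * K / ε := by
          rw [le_div_iff₀ hε]
          nlinarith
        have h3 : 12 * K / ε = 4 * K / ε + 8 * K / ε := by ring
        push_cast
        linarith
      calc _ ≤ 12 * K / ε * s := by gcongr
        _ = ε / (4 * K) * (ε - ε / 4) := by
            rw [hs_def]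
            field_simp
            norm_num
    have hgain' := mul_le_mul_of_nonneg_right hgain (show 0 ≤ ε - ε / 4 by linarith)
    have htri := abs_sub_le (pmixT P j) (∑ i, w i * poi j (x i)) (g j)
    linarith [happrox j, hgx j]
  · have hB : ∀ h : ℝ, 0 ≤ h → h ≤ K → (gridCard h s : ℝ) ≤ 128 * (K / ε ^ 2) ^ 3 := by
      intro h h0 hK'
      have hεp : ε ^ 3 ≤ 1 := pow_le_one₀ hε.le (by linarith)
      have hKp : 1 ≤ K ^ 3 := one_le_pow₀ hK
      calc (gridCard h s : ℝ) ≤ h / s + 1 := gridCard_le h0 hs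
        _ ≤ K / s + 1 := by gcongr
        _ = 64 * (K ^ 3 / ε ^ 3) + 1 := by rw [hs_def]; field_simp
        _ ≤ 128 * (K ^ 3 / ε ^ 3) := by
            have : 1 ≤ K ^ 3 / ε ^ 3 := by
              rw [le_div_iff₀ (by positivity)]
              linarith
            linarith
        _ ≤ 128 * (K ^ 3 / (ε ^ 3 * ε ^ 3)) := by
            gcongr
            exact mul_le_of_le_one_right (by positivity) hεp
        _ = 128 * (K / ε ^ 2) ^ 3 := by rw [div_pow]; ring
    set L := Real.log (K / ε ^ 2) with hL_def
    have hX : 0 < K / ε ^ 2 := by positivity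
    have hL : 2 * Real.log 2 ≤ L := by
      have h4 : (2 : ℝ) ^ 2 ≤ K / ε ^ 2 := by
        rw [le_div_iff₀ (by positivity)]
        nlinarith
      have h := Real.log_le_log (by norm_num) h4
      rw [Real.log_pow] at h
      exact_mod_cast h
    have hlogB : Real.log (128 * (K / ε ^ 2) ^ 3) = 7 * Real.log 2 + 3 * L := by
      rw [Real.log_mul (by norm_num) (by positivity), Real.log_pow,
        show (128 : ℝ) = 2 ^ 7 by norm_num, Real.log_pow]
      norm_num [hL_def]
    have hcard : ((net a b s (m + 1)).card : ℝ) ≤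
        ((128 * (K / ε ^ 2) ^ 3) * (128 * (K / ε ^ 2) ^ 3)) ^ (m + 1) := by
      refine le_trans (b := (((gridCard (b - a) s * gridCard 1 s) ^ (m + 1) : ℕ) : ℝ))
        (by exact_mod_cast card_net_le a b s (m + 1)) ?_
      push_cast
      gcongr
      · exact hB _ (sub_nonneg.2 hab) (by linarith)
      · exact hB _ zero_le_one hK
    have hpos : (0 : ℝ) < (net a b s (m + 1)).card := by
      obtain ⟨g, hg, -⟩ := exists_mem_net (b := b) ha hs (M := m + 1)
        (x := fun _ => a) (w := Fin.cons 1 0) (fun _ => ⟨le_rfl, hab⟩)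
        (Fin.cases zero_le_one fun _ => le_rfl) (by simp [Fin.sum_univ_succ])
      exact_mod_cast Finset.card_pos.2 ⟨g, hg⟩
    have hlog := Real.log_le_log hpos hcard
    rw [Real.log_pow, Real.log_mul (by positivity) (by positivity), hlogB] at hlog
    push_cast at hlog
    have hL0 : 0 ≤ L := le_trans (by positivity) hL
    calc _ ≤ ((m : ℝ) + 1) * (7 * Real.log 2 + 3 * L + (7 * Real.log 2 + 3 * L)) := hlog
      _ ≤ (2 * m) * (13 * L) := by
          gcongr <;> linarith
      _ = 26 * m * L := by ring
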